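/- The ℚ-linear map φ_# : ℚ⟨Y^bi⟩ → ℚ⟨B⟩⁰ is a bijective algebra morphism from (ℚ⟨Y^bi⟩, ∗) to (ℚ⟨B⟩⁰, ∗_b), i.e. φ_#(u ∗ v) = φ_#(u) ∗_b φ_#(v) for all u, v ∈ ℚ⟨Y^bi⟩ and φ_#(𝟏) = 𝟏, and it is weight-graded: it maps the span of words y_{k₁,m₁}⋯y_{k_d,m_d} with k₁+⋯+k_d+m₁+⋯+m_d = w to the span of words b_{s₁}⋯b_{s_l} not starting in b₀ with s₁+⋯+s_l + #{i : s_i = 0} = w. -/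

import Mathlib

/-!
STATEMENT 9: the map `φ_# : ℚ⟨Y^bi⟩ → ℚ⟨B⟩⁰` is a bijective algebra morphism from
`(ℚ⟨Y^bi⟩, ∗)` to `(ℚ⟨B⟩⁰, ∗_b)`, and it is weight-graded.

`ℚ⟨Y^bi⟩` is realized as `List (ℕ × ℕ) →₀ ℚ`, the letter `y_{k,m}` (`k ≥ 1`) being
encoded as `(k-1, m)`; `ℚ⟨B⟩` is realized as `List ℕ →₀ ℚ`, the letter `i : ℕ`
standing for `b_i`.

Expanding the defining generating series of `φ_#` (the series of words of `ℚ⟨B⟩⁰`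
with `Y_i` replaced by `Y₁+⋯+Y_i`), the coefficient of
`X₁^{k₁-1}Y₁^{m₁}⋯X_d^{k_d-1}Y_d^{m_d}` is the sum over all matrices
`c = (c_{ij})_{1 ≤ j ≤ i ≤ d}` (with `c_{ij} = 0` for `j > i`) with column sums
`∑_i c_{ij} = m_j` of `∏_i multinomial(c_{i1},…,c_{id})` times the word
`b_{k₁}b₀^{a₁}⋯b_{k_d}b₀^{a_d}` with row sums `a_i = ∑_j c_{ij}`; hence
`φ_#(y_{k₁,m₁}⋯y_{k_d,m_d}) = (∏_j m_j!) ∑_c (∏_i multinomial) · (word)`.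
-/

open Finsupp

/-- `ℚ⟨Y^bi⟩`; a letter `(a, m)` stands for `y_{a+1,m}`. -/
abbrev QY : Type := List (ℕ × ℕ) →₀ ℚ

/-- `ℚ⟨B⟩`. -/
abbrev QB : Type := List ℕ →₀ ℚ

/-- The word `y_{k₁,m₁} ⋯ y_{k_d,m_d}` of `ℚ⟨Y^bi⟩`. -/
noncomputable def wY (w : List (ℕ × ℕ)) : QY := Finsupp.single w 1

/-- The word `b_{s₁} ⋯ b_{s_l}` of `ℚ⟨B⟩`. -/
noncomputable def wB (w : List ℕ) : QB := Finsupp.single w 1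

/-- Left concatenation by a letter, extended `ℚ`-linearly. -/
noncomputable def consY (a : ℕ × ℕ) (x : QY) : QY := Finsupp.mapDomain (List.cons a) x

/-- Left concatenation by the letter `b_a`, extended `ℚ`-linearly. -/
noncomputable def consB (a : ℕ) (x : QB) : QB := Finsupp.mapDomain (List.cons a) x

/-- The stuffle product `∗` on words of `ℚ⟨Y^bi⟩` (in the encoding `(a,m) = y_{a+1,m}`,
so the diamond of `(a₁,m₁)` and `(a₂,m₂)` is `(a₁+a₂+1, m₁+m₂)`). -/
noncomputable def stufW : List (ℕ × ℕ) → List (ℕ × ℕ) → QY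
  | [], w => wY w
  | x :: u, [] => wY (x :: u)
  | x :: u, y :: v =>
      consY x (stufW u (y :: v)) + consY y (stufW (x :: u) v) +
        consY (x.1 + y.1 + 1, x.2 + y.2) (stufW u v)
  termination_by u v => u.length + v.length

/-- The stuffle product `∗` on `ℚ⟨Y^bi⟩` (ℚ-bilinear extension). -/
noncomputable def stuf (x y : QY) : QY :=
  x.sum fun u a => y.sum fun v b => (a * b) • stufW u v

/-- The balanced quasi-shuffle product `∗_b` on words of `ℚ⟨B⟩`. -/
noncomputable def bshW : List ℕ → List ℕ → QB
  | [], w => wB w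
  | i :: u, [] => wB (i :: u)
  | i :: u, j :: v =>
      consB i (bshW u (j :: v)) + consB j (bshW (i :: u) v) +
        (if 1 ≤ i ∧ 1 ≤ j then consB (i + j) (bshW u v) else 0)
  termination_by u v => u.length + v.length

/-- The balanced quasi-shuffle product `∗_b` on `ℚ⟨B⟩` (ℚ-bilinear extension). -/
noncomputable def bsh (x y : QB) : QB :=
  x.sum fun u a => y.sum fun v b => (a * b) • bshW u v

/-- `ℚ⟨B⟩⁰`: the subspace of `ℚ⟨B⟩` spanned by `𝟏` and the words not starting in `b₀`. -/
noncomputable def QB0 : Submodule ℚ QB :=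
  Submodule.span ℚ {x | ∃ w : List ℕ, w.head? ≠ some 0 ∧ x = wB w}

/-- The set of matrices `c` (given by their columns `c j : Fin d → ℕ`) with column sums
`∑_i c j i = m j` and vanishing strictly above the diagonal (`c j i = 0` for `i < j`). -/
noncomputable def matSet (d : ℕ) (m : Fin d → ℕ) : Finset (Fin d → Fin d → ℕ) :=
  (Fintype.piFinset fun j : Fin d => Finset.Nat.antidiagonalTuple d (m j)).filter
    fun c => ∀ i j : Fin d, i < j → c j i = 0

/-- `φ_#` on the word with letters `y_{(w i).1 + 1, (w i).2}`. -/
noncomputable def phiW (w : List (ℕ × ℕ)) : QB :=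
  ∑ c ∈ matSet w.length fun j => (w.get j).2,
    ((∏ j : Fin w.length, (((w.get j).2).factorial : ℚ)) *
        ∏ i : Fin w.length, (Nat.multinomial Finset.univ (fun j => c j i) : ℚ)) •
      wB ((List.ofFn fun i : Fin w.length =>
        ((w.get i).1 + 1) :: List.replicate (∑ j : Fin w.length, c j i) 0).flatten)

/-- The map `φ_# : ℚ⟨Y^bi⟩ → ℚ⟨B⟩⁰ ⊆ ℚ⟨B⟩` (ℚ-linear extension). -/
noncomputable def phi (x : QY) : QB := x.sum fun w a => a • phiW w

/-- The weight of a word of `ℚ⟨Y^bi⟩`: `wt(y_{k₁,m₁}⋯y_{k_d,m_d}) = ∑ (kᵢ + mᵢ)`. -/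
def wtY (w : List (ℕ × ℕ)) : ℕ := (w.map fun p => p.1 + 1 + p.2).sum

/-- The weight of a word of `ℚ⟨B⟩`: `wt(b_{s₁}⋯b_{s_l}) = s₁+⋯+s_l + #{i ∣ sᵢ = 0}`. -/
def wtB (w : List ℕ) : ℕ := w.sum + w.count 0


theorem consB_wB (a : ℕ) (w : List ℕ) : consB a (wB w) = wB (a :: w) := by
  simp [consB, wB, Finsupp.mapDomain_single]

theorem consY_wY (a : ℕ × ℕ) (w : List (ℕ × ℕ)) : consY a (wY w) = wY (a :: w) := by
  simp [consY, wY, Finsupp.mapDomain_single]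

/-- linear version of `consB` -/
noncomputable def consBL (a : ℕ) : QB →ₗ[ℚ] QB := Finsupp.lmapDomain ℚ ℚ (List.cons a)

/-- linear version of `consY` -/
noncomputable def consYL (a : ℕ × ℕ) : QY →ₗ[ℚ] QY := Finsupp.lmapDomain ℚ ℚ (List.cons a)

theorem consB_eq (a : ℕ) (x : QB) : consB a x = consBL a x := rfl
theorem consY_eq (a : ℕ × ℕ) (x : QY) : consY a x = consYL a x := rfl

theorem consBL_wB (a : ℕ) (w : List ℕ) : consBL a (wB w) = wB (a :: w) := consB_wB a w
theorem consYL_wY (a : ℕ × ℕ) (w : List (ℕ × ℕ)) : consYL a (wY w) = wY (a :: w) := consY_wY a w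

/-- linear maps out of `QB` agreeing on words agree -/
theorem extB {M : Type*} [AddCommMonoid M] [Module ℚ M] {f g : QB →ₗ[ℚ] M}
    (h : ∀ w, f (wB w) = g (wB w)) : f = g := by
  apply Finsupp.lhom_ext'
  intro w
  ext
  exact h w

theorem extY {M : Type*} [AddCommMonoid M] [Module ℚ M] {f g : QY →ₗ[ℚ] M}
    (h : ∀ w, f (wY w) = g (wY w)) : f = g := by
  apply Finsupp.lhom_ext'
  intro w
  ext
  exact h w

/-- insertion of one letter `b₀` on words -/
noncomputable def DW : List ℕ → QB
  | [] => wB [0]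
  | i :: w => wB (0 :: i :: w) + consB i (DW w)

/-- insertion of one letter `b₀` -/
noncomputable def DL : QB →ₗ[ℚ] QB := Finsupp.linearCombination ℚ DW

theorem DL_wB (w : List ℕ) : DL (wB w) = DW w := by
  simp [DL, wB, Finsupp.linearCombination_single]

theorem DL_cons (i : ℕ) (x : QB) :
    DL (consBL i x) = consBL 0 (consBL i x) + consBL i (DL x) := by
  have : DL ∘ₗ consBL i = consBL 0 ∘ₗ consBL i + consBL i ∘ₗ DL := by
    apply extB
    intro w
    simp [consBL_wB, DL_wB, DW, consB_eq]
  exact LinearMap.congr_fun this x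

/-- bilinear version of `bsh` -/
noncomputable def bshL : QB →ₗ[ℚ] QB →ₗ[ℚ] QB :=
  Finsupp.linearCombination ℚ (fun u => Finsupp.linearCombination ℚ (bshW u))

theorem bsh_eq (x y : QB) : bsh x y = bshL x y := by
  simp only [bsh, bshL, Finsupp.linearCombination_apply, Finsupp.sum, LinearMap.sum_apply,
    LinearMap.smul_apply, Finset.smul_sum, smul_smul]

theorem bshL_wB (u v : List ℕ) : bshL (wB u) (wB v) = bshW u v := by
  simp [bshL, wB, Finsupp.linearCombination_single]

/-- bilinear version of `stuf` -/
noncomputable def stufL : QY →ₗ[ℚ] QY →ₗ[ℚ] QY :=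
  Finsupp.linearCombination ℚ (fun u => Finsupp.linearCombination ℚ (stufW u))

theorem stuf_eq (x y : QY) : stuf x y = stufL x y := by
  simp only [stuf, stufL, Finsupp.linearCombination_apply, Finsupp.sum, LinearMap.sum_apply,
    LinearMap.smul_apply, Finset.smul_sum, smul_smul]

theorem stufL_wY (u v : List (ℕ × ℕ)) : stufL (wY u) (wY v) = stufW u v := by
  simp [stufL, wY, Finsupp.linearCombination_single]

theorem bshL_one_left (y : QB) : bshL (wB []) y = y := by
  have : bshL (wB []) = LinearMap.id := by
    apply extB
    intro w
    rw [bshL_wB]; simp [bshW]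
  rw [this]; rfl

theorem bshL_one_right (x : QB) : bshL x (wB []) = x := by
  have : bshL.flip (wB []) = LinearMap.id := by
    apply extB
    intro w
    rw [LinearMap.flip_apply, bshL_wB]
    cases w <;> simp [bshW]
  exact LinearMap.congr_fun this x

/-- the diamond part of the product -/
noncomputable def diaL (i j : ℕ) : QB →ₗ[ℚ] QB := if 1 ≤ i ∧ 1 ≤ j then consBL (i + j) else 0

theorem bshL_cons (i j : ℕ) (x y : QB) :
    bshL (consBL i x) (consBL j y) = consBL i (bshL x (consBL j y))
      + consBL j (bshL (consBL i x) y) + diaL i j (bshL x y) := by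
  have : (bshL.compl₁₂ (consBL i) (consBL j)) =
      (bshL.compl₁₂ LinearMap.id (consBL j)).compr₂ (consBL i) +
      (bshL.compl₁₂ (consBL i) LinearMap.id).compr₂ (consBL j) +
      bshL.compr₂ (diaL i j) := by
    apply extB
    intro u
    apply extB
    intro v
    simp only [LinearMap.compl₁₂_apply, LinearMap.compr₂_apply, LinearMap.add_apply, consBL_wB,
      bshL_wB, LinearMap.id_apply]
    rw [bshW]
    simp only [diaL, consB_eq]
    split_ifs <;> simp
  exact LinearMap.congr_fun (LinearMap.congr_fun this x) y

theorem bshW_comm (u v : List ℕ) : bshW u v = bshW v u := by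
  induction u generalizing v with
  | nil => cases v <;> simp [bshW]
  | cons i u ihu =>
    induction v with
    | nil => simp [bshW]
    | cons j v ihv =>
      rw [bshW, bshW, ihu, ihv, ihu v, add_comm (consB i _), add_comm i j]
      simp only [and_comm]

theorem bshL_comm (x y : QB) : bshL x y = bshL y x := by
  have : bshL = bshL.flip := by
    apply extB
    intro u
    apply extB
    intro v
    rw [LinearMap.flip_apply, bshL_wB, bshL_wB, bshW_comm]
  conv_lhs => rw [this]
  rfl

theorem DL_dia (i j : ℕ) (x : QB) :
    DL (diaL i j x) = consBL 0 (diaL i j x) + diaL i j (DL x) := by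
  unfold diaL
  split_ifs
  · exact DL_cons _ _
  · simp

theorem bshL_zero_left (v : List ℕ) : bshL (wB [0]) (wB v) = DL (wB v) := by
  induction v with
  | nil => rw [bshL_one_right, DL_wB]; rfl
  | cons j v ih =>
    rw [← consBL_wB, ← consBL_wB j, bshL_cons, bshL_one_left, DL_cons, consBL_wB j, consBL_wB 0 [], ih]
    simp [diaL, bshL_one_left]

theorem DL_bshW (u v : List ℕ) : bshL (DL (wB u)) (wB v) = DL (bshL (wB u) (wB v)) := by
  induction u generalizing v with
  | nil => rw [bshL_one_left, DL_wB, DW, bshL_zero_left]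
  | cons i u ihu =>
    induction v with
    | nil => rw [bshL_one_right, bshL_one_right]
    | cons j v ihv =>
      have ihu' := ihu (j :: v)
      have ihu2 := ihu v
      rw [← consBL_wB] at ihu' ihv
      rw [← consBL_wB, ← consBL_wB j]
      rw [bshL_cons]
      simp only [map_add, DL_cons, DL_dia]
      rw [← ihu', ← ihv, ← ihu2]
      simp only [map_add, DL_cons, LinearMap.add_apply, bshL_cons]
      simp [diaL]
      abel

theorem DL_bshL (x y : QB) : bshL (DL x) y = DL (bshL x y) := by
  have : (bshL.compl₁₂ DL LinearMap.id) = bshL.compr₂ DL := by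
    apply extB
    intro u
    apply extB
    intro v
    exact DL_bshW u v
  exact LinearMap.congr_fun (LinearMap.congr_fun this x) y

theorem DL_pow_bshL (m : ℕ) (x y : QB) : bshL ((DL ^ m) x) y = (DL ^ m) (bshL x y) := by
  induction m generalizing x with
  | zero => simp
  | succ m ih => rw [pow_succ, Module.End.mul_apply, Module.End.mul_apply, ih, DL_bshL]

theorem DL_pow_bshL' (m : ℕ) (x y : QB) : bshL x ((DL ^ m) y) = (DL ^ m) (bshL x y) := by
  rw [bshL_comm, DL_pow_bshL, bshL_comm]

/-- linear version of `phi` -/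
noncomputable def phiL : QY →ₗ[ℚ] QB := Finsupp.linearCombination ℚ phiW

theorem phi_eq (x : QY) : phi x = phiL x := rfl

theorem phiL_wY (w : List (ℕ × ℕ)) : phiL (wY w) = phiW w := by
  simp [phiL, wY, Finsupp.linearCombination_single]

theorem phiW_nil : phiW [] = wB [] := by
  have : matSet 0 (fun j : Fin 0 => (([] : List (ℕ × ℕ)).get j).2) = Finset.univ := by
    ext c
    simp [matSet]
  unfold phiW
  simp only [List.length_nil]
  rw [this]
  simp

/-- divided powers of `DL` -/
noncomputable def EL (m : ℕ) : QB →ₗ[ℚ] QB := ((m.factorial : ℚ)⁻¹) • DL ^ m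

theorem EL_zero (x : QB) : EL 0 x = x := by simp [EL]

theorem DL_EL (m : ℕ) (x : QB) : DL (EL m x) = ((m : ℚ) + 1) • EL (m + 1) x := by
  have h : (m : ℚ) + 1 ≠ 0 := by positivity
  have h2 : (m.factorial : ℚ) ≠ 0 := by positivity
  simp only [EL, LinearMap.smul_apply, map_smul, smul_smul, pow_succ', Module.End.mul_apply]
  congr 1
  rw [Nat.factorial_succ]
  push_cast
  field_simp

theorem EL_succ (m : ℕ) (x : QB) : EL (m + 1) x = ((m : ℚ) + 1)⁻¹ • DL (EL m x) := by
  have h : (m : ℚ) + 1 ≠ 0 := by positivity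
  rw [DL_EL, smul_smul, inv_mul_cancel₀ h, one_smul]

theorem EL_leibniz (F : ℕ → QB →ₗ[ℚ] QB)
    (h : ∀ c x, DL (F c x) = ((c : ℚ) + 1) • F (c + 1) x + F c (DL x)) (m : ℕ) (x : QB) :
    EL m (F 0 x) = ∑ p ∈ Finset.HasAntidiagonal.antidiagonal m, F p.1 (EL p.2 x) := by
  induction m with
  | zero => simp [EL_zero]
  | succ m ih =>
    have hm : (m : ℚ) + 1 ≠ 0 := by positivity
    rw [EL_succ, ih, inv_smul_eq_iff₀ hm]
    have key : ((m : ℚ) + 1) • ∑ p ∈ Finset.HasAntidiagonal.antidiagonal (m + 1), F p.1 (EL p.2 x) =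
        ∑ p ∈ Finset.HasAntidiagonal.antidiagonal (m + 1), (p.1 : ℚ) • F p.1 (EL p.2 x) +
        ∑ p ∈ Finset.HasAntidiagonal.antidiagonal (m + 1), (p.2 : ℚ) • F p.1 (EL p.2 x) := by
      rw [Finset.smul_sum, ← Finset.sum_add_distrib]
      apply Finset.sum_congr rfl
      intro p hp
      rw [Finset.HasAntidiagonal.mem_antidiagonal] at hp
      rw [← add_smul]
      congr 1
      exact_mod_cast hp.symm
    rw [key, Finset.Nat.sum_antidiagonal_succ, Finset.Nat.sum_antidiagonal_succ', map_sum]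
    simp only [h, DL_EL, Finset.sum_add_distrib, map_smul]
    simp

theorem DL_zeros (a : ℕ) (y : QB) :
    DL ((consBL 0 ^ a) y) = (a : ℚ) • (consBL 0 ^ (a + 1)) y + (consBL 0 ^ a) (DL y) := by
  induction a with
  | zero => simp
  | succ a ih =>
    rw [pow_succ', Module.End.mul_apply, DL_cons, ih]
    simp only [pow_succ', Module.End.mul_apply, map_add, map_smul]
    push_cast
    module

theorem EL_zeros_nil (a m : ℕ) : EL m ((consBL 0 ^ a) (wB [])) =
    ((a + m).choose m : ℚ) • (consBL 0 ^ (a + m)) (wB []) := by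
  induction m with
  | zero => simp [EL_zero]
  | succ m ih =>
    have hm : (m : ℚ) + 1 ≠ 0 := by positivity
    have h0 : DL (wB []) = consBL 0 (wB []) := by rw [DL_wB, DW, consBL_wB]
    have h := Nat.add_one_mul_choose_eq (a + m) m
    have h' : ((a : ℚ) + m + 1) * ((a + m).choose m : ℚ)
      = ((a + m + 1).choose (m + 1) : ℚ) * ((m : ℚ) + 1) := by exact_mod_cast h
    rw [EL_succ, ih, inv_smul_eq_iff₀ hm, map_smul, DL_zeros, h0, ← Module.End.mul_apply,
      ← pow_succ, ← add_assoc, smul_smul, mul_comm _ (_ : ℚ), ← h']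
    push_cast
    module

theorem EL_zeros_cons (a m i : ℕ) (x : QB) : EL m ((consBL 0 ^ a) (consBL i x)) =
    ∑ p ∈ Finset.HasAntidiagonal.antidiagonal m,
      ((a + p.1).choose p.1 : ℚ) • (consBL 0 ^ (a + p.1)) (consBL i (EL p.2 x)) := by
  have := EL_leibniz
    (fun c => ((a + c).choose c : ℚ) • ((consBL 0 ^ (a + c)) ∘ₗ consBL i)) ?_ m x
  · simpa using this
  · intro c x
    have h := Nat.add_one_mul_choose_eq (a + c) c
    have h' : ((a : ℚ) + c + 1) * ((a + c).choose c : ℚ)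
      = ((a + c + 1).choose (c + 1) : ℚ) * ((c : ℚ) + 1) := by exact_mod_cast h
    simp only [LinearMap.smul_apply, LinearMap.comp_apply, map_smul, DL_zeros, DL_cons, map_add]
    rw [← Module.End.mul_apply _ (consBL 0), ← pow_succ, ← add_assoc, ← add_assoc, smul_smul, mul_comm _ (_ : ℚ), ← h']
    push_cast
    module

theorem sum_tuple_succ {M : Type*} [AddCommMonoid M] (n m : ℕ) (f : (Fin (n + 1) → ℕ) → M) :
    ∑ t ∈ Finset.Nat.antidiagonalTuple (n + 1) m, f t =
      ∑ p ∈ Finset.HasAntidiagonal.antidiagonal m, ∑ s ∈ Finset.Nat.antidiagonalTuple n p.2,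
        f (Fin.cons p.1 s) := by
  rw [Finset.sum_sigma']
  refine Finset.sum_bij' (fun t _ => ⟨(t 0, ∑ i : Fin n, t i.succ), fun i => t i.succ⟩)
    (fun q _ => Fin.cons q.1.1 q.2) ?_ ?_ ?_ ?_ ?_
  · intro t ht
    rw [Finset.Nat.mem_antidiagonalTuple, Fin.sum_univ_succ] at ht
    simp [Finset.Nat.mem_antidiagonalTuple, ht]
  · rintro ⟨⟨p1, p2⟩, s⟩ hq
    simp only [Finset.mem_sigma, Finset.HasAntidiagonal.mem_antidiagonal, Finset.Nat.mem_antidiagonalTuple] at hq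
    rw [Finset.Nat.mem_antidiagonalTuple, Fin.sum_univ_succ]
    simp [hq.1, hq.2]
  · intro t ht
    exact Fin.cons_self_tail t
  · rintro ⟨⟨p1, p2⟩, s⟩ hq
    simp only [Finset.mem_sigma, Finset.HasAntidiagonal.mem_antidiagonal, Finset.Nat.mem_antidiagonalTuple] at hq
    obtain ⟨h1, rfl⟩ := hq
    simp
  · intro t ht
    congr 1
    exact (Fin.cons_self_tail t).symm

/-- the word `b_{k₁} b₀^{a₁} ⋯` -/
def Wd (d : ℕ) (k a : Fin d → ℕ) : List ℕ :=
  (List.ofFn fun i : Fin d => (k i + 1) :: List.replicate (a i) 0).flatten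

theorem wB_replicate (a : ℕ) (w : List ℕ) :
    wB (List.replicate a 0 ++ w) = (consBL 0 ^ a) (wB w) := by
  induction a with
  | zero => simp
  | succ a ih => rw [pow_succ', Module.End.mul_apply, ← ih, consBL_wB]; rfl

theorem Wd_succ (d : ℕ) (k a : Fin (d + 1) → ℕ) :
    wB (Wd (d + 1) k a) = consBL (k 0 + 1) ((consBL 0 ^ (a 0))
      (wB (Wd d (fun i => k i.succ) (fun i => a i.succ)))) := by
  rw [← wB_replicate, consBL_wB]
  simp [Wd, List.ofFn_succ]

theorem EL_word (d : ℕ) (k a : Fin d → ℕ) (m a0 : ℕ) :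
    EL m ((consBL 0 ^ a0) (wB (Wd d k a))) =
      ∑ t ∈ Finset.Nat.antidiagonalTuple (d + 1) m,
        (((a0 + t 0).choose (t 0) : ℚ) * ∏ i : Fin d, ((a i + t i.succ).choose (t i.succ) : ℚ)) •
          (consBL 0 ^ (a0 + t 0)) (wB (Wd d k (fun i => a i + t i.succ))) := by
  induction d generalizing m a0 with
  | zero =>
    have h : Wd 0 k a = [] := by simp [Wd]
    simp [Wd, EL_zeros_nil]
  | succ d ih =>
    rw [Wd_succ, EL_zeros_cons, sum_tuple_succ]
    apply Finset.sum_congr rfl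
    intro p _
    rw [ih, map_sum, map_sum, Finset.smul_sum]
    apply Finset.sum_congr rfl
    intro s _
    rw [map_smul, map_smul, smul_smul, Wd_succ]
    simp only [Fin.cons_zero, Fin.cons_succ, Fin.prod_univ_succ]

theorem multinomial_fin_succ (d : ℕ) (f : Fin (d + 1) → ℕ) :
    Nat.multinomial Finset.univ f = ((∑ j : Fin d, f j.succ) + f 0).choose (f 0) *
      Nat.multinomial Finset.univ (fun j : Fin d => f j.succ) := by
  have h1 := Nat.multinomial_spec Finset.univ f
  have h2 := Nat.multinomial_spec Finset.univ (fun j : Fin d => f j.succ)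
  rw [Fin.sum_univ_succ, Fin.prod_univ_succ] at h1
  have h3 := Nat.add_choose_mul_factorial_mul_factorial (∑ j : Fin d, f j.succ) (f 0)
  rw [add_comm (f 0)] at h1
  have hp : 0 < (f 0).factorial * ∏ j : Fin d, (f j.succ).factorial := by positivity
  apply Nat.eq_of_mul_eq_mul_left hp
  rw [h1, ← h3, ← h2]
  ring

/-- `phiW` in terms of tuples -/
noncomputable def phiM (d : ℕ) (k m : Fin d → ℕ) : QB :=
  ∑ c ∈ matSet d m,
    ((∏ j : Fin d, ((m j).factorial : ℚ)) *
        ∏ i : Fin d, (Nat.multinomial Finset.univ (fun j => c j i) : ℚ)) •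
      wB (Wd d k (fun i => ∑ j : Fin d, c j i))

theorem mem_matSet (d : ℕ) (m : Fin d → ℕ) (c : Fin d → Fin d → ℕ) :
    c ∈ matSet d m ↔ (∀ j, ∑ i, c j i = m j) ∧ ∀ i j : Fin d, i < j → c j i = 0 := by
  simp [matSet, Finset.Nat.mem_antidiagonalTuple]

theorem sum_matSet_succ {M : Type*} [AddCommMonoid M] (d : ℕ) (m : Fin (d + 1) → ℕ)
    (f : (Fin (d + 1) → Fin (d + 1) → ℕ) → M) :
    ∑ c ∈ matSet (d + 1) m, f c =
      ∑ c ∈ matSet d (fun j => m j.succ), ∑ t ∈ Finset.Nat.antidiagonalTuple (d + 1) (m 0),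
        f (Fin.cons t (fun j => Fin.cons 0 (c j))) := by
  rw [← Finset.sum_product']
  have hinv : ∀ c ∈ matSet (d + 1) m,
      (Fin.cons (c 0) (fun j => Fin.cons 0 (fun i => c j.succ i.succ)) :
        Fin (d + 1) → Fin (d + 1) → ℕ) = c := by
    intro c hc
    rw [mem_matSet] at hc
    funext j i
    refine Fin.cases ?_ (fun j => ?_) j
    · simp
    · refine Fin.cases ?_ (fun i => ?_) i
      · simp [hc.2 0 j.succ (Fin.succ_pos j)]
      · simp
  refine Finset.sum_bij' (fun c _ => (fun j i => c j.succ i.succ, c 0))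
    (fun q _ => Fin.cons q.2 (fun j => Fin.cons 0 (q.1 j))) ?_ ?_ ?_ ?_ ?_
  · intro c hc
    rw [mem_matSet] at hc
    rw [Finset.mem_product, mem_matSet, Finset.Nat.mem_antidiagonalTuple]
    refine ⟨⟨fun j => ?_, fun i j hij => hc.2 _ _ (Fin.succ_lt_succ_iff.mpr hij)⟩, hc.1 0⟩
    have := hc.1 j.succ
    rw [Fin.sum_univ_succ, hc.2 0 j.succ (Fin.succ_pos j), zero_add] at this
    exact this
  · rintro ⟨c, t⟩ hq
    rw [Finset.mem_product, mem_matSet, Finset.Nat.mem_antidiagonalTuple] at hq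
    obtain ⟨⟨h1, h2⟩, h3⟩ := hq
    rw [mem_matSet]
    constructor
    · intro j
      refine Fin.cases ?_ (fun j => ?_) j
      · simpa using h3
      · simpa [Fin.sum_univ_succ] using h1 j
    · intro i j
      refine Fin.cases ?_ (fun j => ?_) j
      · intro h; exact absurd h (Fin.not_lt_zero _)
      · refine Fin.cases ?_ (fun i => ?_) i
        · intro _; simp
        · intro h; simpa using h2 i j (Fin.succ_lt_succ_iff.mp h)
  · exact hinv
  · rintro ⟨c, t⟩ hq
    simp
  · intro c hc
    rw [hinv c hc]

theorem phiM_succ (d : ℕ) (k m : Fin (d + 1) → ℕ) :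
    phiM (d + 1) k m = consBL (k 0 + 1) ((DL ^ (m 0))
      (phiM d (fun j => k j.succ) (fun j => m j.succ))) := by
  have hD : ∀ x, (DL ^ (m 0)) x = ((m 0).factorial : ℚ) • EL (m 0) x := by
    intro x
    have h2 : ((m 0).factorial : ℚ) ≠ 0 := by positivity
    simp only [EL, LinearMap.smul_apply, smul_smul, mul_inv_cancel₀ h2, one_smul]
  unfold phiM
  rw [sum_matSet_succ, hD, map_sum, Finset.smul_sum, map_sum]
  apply Finset.sum_congr rfl
  intro c _
  have h := EL_word d (fun j => k j.succ) (fun i => ∑ j : Fin d, c j i) (m 0) 0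
  rw [pow_zero, Module.End.one_apply] at h
  rw [map_smul, map_smul, h, Finset.smul_sum, map_sum, Finset.smul_sum]
  apply Finset.sum_congr rfl
  intro t _
  rw [smul_smul, map_smul, smul_smul, Wd_succ]
  have hm0 : Nat.multinomial Finset.univ (fun j : Fin (d + 1) =>
      (Fin.cons t (fun j => Fin.cons 0 (c j)) : Fin (d + 1) → Fin (d + 1) → ℕ) j 0) = 1 := by
    rw [multinomial_fin_succ]
    simp [Nat.multinomial]
  rw [Fin.prod_univ_succ, Fin.prod_univ_succ (fun i => ((Nat.multinomial _ _ : ℕ) : ℚ)), hm0]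
  congr 1
  · simp only [multinomial_fin_succ, Fin.cons_zero, Fin.cons_succ, zero_add, Nat.choose_self]
    push_cast
    rw [Finset.prod_mul_distrib]
    ring
  · simp [Fin.sum_univ_succ, add_comm]

theorem phiW_eq (w : List (ℕ × ℕ)) :
    phiW w = phiM w.length (fun j => (w.get j).1) (fun j => (w.get j).2) := rfl

theorem phiW_cons (y : ℕ × ℕ) (w : List (ℕ × ℕ)) :
    phiW (y :: w) = consBL (y.1 + 1) ((DL ^ y.2) (phiW w)) := by
  rw [phiW_eq, phiW_eq]
  exact phiM_succ w.length _ _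

theorem phiL_cons (y : ℕ × ℕ) (x : QY) :
    phiL (consYL y x) = consBL (y.1 + 1) ((DL ^ y.2) (phiL x)) := by
  have : phiL ∘ₗ consYL y = consBL (y.1 + 1) ∘ₗ (DL ^ y.2) ∘ₗ phiL := by
    apply extY
    intro w
    simp only [LinearMap.comp_apply, consYL_wY, phiL_wY, phiW_cons]
  exact LinearMap.congr_fun this x

theorem phiL_nil : phiL (wY []) = wB [] := by rw [phiL_wY, phiW_nil]

theorem phiL_stufW (u v : List (ℕ × ℕ)) : phiL (stufW u v) = bshL (phiW u) (phiW v) := by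
  induction u generalizing v with
  | nil => rw [stufW, phiW_nil, bshL_one_left, phiL_wY]
  | cons x u ihu =>
    induction v with
    | nil => rw [stufW, phiW_nil, bshL_one_right, phiL_wY]
    | cons y v ihv =>
      rw [stufW]
      simp only [consY_eq, map_add, phiL_cons]
      rw [ihu, ihu, ihv, phiW_cons x, phiW_cons y, bshL_cons, DL_pow_bshL, DL_pow_bshL',
        DL_pow_bshL, DL_pow_bshL', pow_add, Module.End.mul_apply]
      have : diaL (x.1 + 1) (y.1 + 1) = consBL (x.1 + y.1 + 1 + 1) := by
        rw [diaL, if_pos (by omega)]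
        congr 1
        omega
      rw [this]

theorem phiL_stufL (x y : QY) : phiL (stufL x y) = bshL (phiL x) (phiL y) := by
  have : stufL.compr₂ phiL = bshL.compl₁₂ phiL phiL := by
    apply extY
    intro u
    apply extY
    intro v
    simp only [LinearMap.compr₂_apply, LinearMap.compl₁₂_apply, stufL_wY, phiL_stufW, phiL_wY]
  exact LinearMap.congr_fun (LinearMap.congr_fun this x) y

/-- removal of a leading letter `b_b` on words -/
noncomputable def lamW (b : ℕ) : List ℕ → QB
  | [] => 0
  | i :: w => if i = b then wB w else 0

/-- removal of a leading letter `b_b` -/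
noncomputable def lamB (b : ℕ) : QB →ₗ[ℚ] QB := Finsupp.linearCombination ℚ (lamW b)

theorem lamB_wB (b : ℕ) (w : List ℕ) : lamB b (wB w) = lamW b w := by
  simp [lamB, wB, Finsupp.linearCombination_single]

theorem lamB_cons_self (b : ℕ) (x : QB) : lamB b (consBL b x) = x := by
  have : lamB b ∘ₗ consBL b = LinearMap.id := by
    apply extB
    intro w
    simp [consBL_wB, lamB_wB, lamW]
  exact LinearMap.congr_fun this x

theorem lamB_cons_ne (b i : ℕ) (h : i ≠ b) (x : QB) : lamB b (consBL i x) = 0 := by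
  have : lamB b ∘ₗ consBL i = 0 := by
    apply extB
    intro w
    simp [consBL_wB, lamB_wB, lamW, h]
  exact LinearMap.congr_fun this x

theorem lamB_DL (x : QB) : lamB 0 (DL x) = DL (lamB 0 x) + x := by
  have : lamB 0 ∘ₗ DL = DL ∘ₗ lamB 0 + LinearMap.id := by
    apply extB
    intro w
    simp only [LinearMap.comp_apply, LinearMap.add_apply, LinearMap.id_apply]
    cases w with
    | nil => simp [DL_wB, DW, lamB_wB, lamW]
    | cons i w =>
      rw [← consBL_wB, DL_cons, map_add, lamB_cons_self]
      by_cases h : i = 0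
      · subst h
        rw [lamB_cons_self, lamB_cons_self, add_comm]
      · rw [lamB_cons_ne 0 i h, lamB_cons_ne 0 i h]
        simp
  exact LinearMap.congr_fun this x

theorem lamB_DL_pow (m : ℕ) (z : QB) (hz : lamB 0 z = 0) :
    lamB 0 ((DL ^ (m + 1)) z) = ((m : ℚ) + 1) • (DL ^ m) z := by
  induction m with
  | zero => simp [lamB_DL, hz]
  | succ m ih =>
    rw [pow_succ', Module.End.mul_apply, lamB_DL, ih, map_smul, ← Module.End.mul_apply,
      ← pow_succ']
    push_cast
    module

theorem DL_free (N : ℕ) (z : ℕ → QB) (hz : ∀ m, lamB 0 (z m) = 0)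
    (h : ∑ m ∈ Finset.range N, (DL ^ m) (z m) = 0) : ∀ m < N, z m = 0 := by
  induction N generalizing z with
  | zero => intro m hm; omega
  | succ N ih =>
    have h' := congrArg (lamB 0) h
    rw [Finset.sum_range_succ', map_add, map_sum, map_zero] at h'
    simp only [lamB_DL_pow _ _ (hz _), pow_zero, Module.End.one_apply, hz, add_zero] at h'
    have key := ih (fun m => ((m : ℚ) + 1) • z (m + 1)) (fun m => by simp [hz])
      (by simpa only [map_smul] using h')
    have hs : ∀ m < N, z (m + 1) = 0 := by
      intro m hm
      have h1 : (m : ℚ) + 1 ≠ 0 := by positivity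
      exact (smul_eq_zero.mp (key m hm)).resolve_left h1
    rw [Finset.sum_range_succ', Finset.sum_eq_zero, zero_add] at h
    · intro m hm
      cases m with
      | zero => simpa using h
      | succ m => exact hs m (by omega)
    · intro m hm
      rw [hs m (Finset.mem_range.mp hm), map_zero]

theorem lamB_phiL (x : QY) : lamB 0 (phiL x) = 0 := by
  have : lamB 0 ∘ₗ phiL = 0 := by
    apply extY
    intro w
    rw [LinearMap.comp_apply, phiL_wY]
    cases w with
    | nil => rw [phiW_nil, lamB_wB]; rfl
    | cons y w => rw [phiW_cons, lamB_cons_ne _ _ (by omega)]; rfl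
  exact LinearMap.congr_fun this x

/-- splitting off the first letter `(a, m)`, indexed by `m`, on words -/
noncomputable def psiW (a : ℕ) : List (ℕ × ℕ) → (ℕ →₀ QY)
  | [] => 0
  | y :: w => if y.1 = a then Finsupp.single y.2 (wY w) else 0

/-- splitting off the first letter `(a, m)`, indexed by `m` -/
noncomputable def psiY (a : ℕ) : QY →ₗ[ℚ] (ℕ →₀ QY) := Finsupp.linearCombination ℚ (psiW a)

theorem psiY_wY (a : ℕ) (w : List (ℕ × ℕ)) : psiY a (wY w) = psiW a w := by
  simp [psiY, wY, Finsupp.linearCombination_single]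

theorem psiY_apply (a m : ℕ) (w : List (ℕ × ℕ)) (x : QY) :
    psiY a x m w = x ((a, m) :: w) := by
  have : (Finsupp.lapply w : QY →ₗ[ℚ] ℚ) ∘ₗ (Finsupp.lapply m : (ℕ →₀ QY) →ₗ[ℚ] QY) ∘ₗ psiY a
      = (Finsupp.lapply ((a, m) :: w) : QY →ₗ[ℚ] ℚ) := by
    apply extY
    intro v
    simp only [LinearMap.comp_apply, psiY_wY, Finsupp.lapply_apply]
    rcases v with _ | ⟨⟨b, n⟩, v⟩
    · simp [psiW, wY]
    · simp only [psiW, wY]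
      by_cases hb : b = a
      · by_cases hn : n = m
        · subst hb hn
          by_cases hv : v = w
          · subst hv; simp
          · simp [hv]
        · simp [hb, hn]
      · simp [hb]
  exact LinearMap.congr_fun this x

theorem lamB_succ_phiL (a : ℕ) (x : QY) :
    lamB (a + 1) (phiL x) = (psiY a x).sum fun m z => (DL ^ m) (phiL z) := by
  have : lamB (a + 1) ∘ₗ phiL =
      (Finsupp.lsum ℚ (fun m => (DL ^ m) ∘ₗ phiL) : (ℕ →₀ QY) →ₗ[ℚ] QB) ∘ₗ psiY a := by
    apply extY
    intro w
    simp only [LinearMap.comp_apply, phiL_wY, psiY_wY]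
    cases w with
    | nil => simp [psiW, phiW_nil, lamB_wB, lamW]
    | cons y w =>
      rw [phiW_cons]
      by_cases h : y.1 = a
      · subst h
        simp [psiW, lamB_cons_self, phiL_wY]
      · rw [lamB_cons_ne _ _ (by omega)]
        simp [psiW, h]
  exact LinearMap.congr_fun this x

theorem phiL_apply_nil (x : QY) : phiL x [] = x [] := by
  have : (Finsupp.lapply [] : QB →ₗ[ℚ] ℚ) ∘ₗ phiL = (Finsupp.lapply [] : QY →ₗ[ℚ] ℚ) := by
    apply extY
    intro w
    simp only [LinearMap.comp_apply, phiL_wY, Finsupp.lapply_apply]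
    cases w with
    | nil => simp [phiW_nil, wB, wY]
    | cons y w =>
      rw [phiW_cons]
      have h2 : ∀ (i : ℕ) (z : QB), consBL i z [] = 0 := by
        intro i z
        apply Finsupp.mapDomain_of_notMem_range
        simp
      rw [h2]
      simp [wY]
  exact LinearMap.congr_fun this x

theorem phiL_ker (w : List (ℕ × ℕ)) : ∀ x : QY, phiL x = 0 → x w = 0 := by
  induction w with
  | nil => intro x hx; rw [← phiL_apply_nil, hx]; rfl
  | cons y w ih =>
    obtain ⟨a, m⟩ := y
    intro x hx
    rw [← psiY_apply]
    apply ih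
    have h := lamB_succ_phiL a x
    rw [hx, map_zero] at h
    obtain ⟨N, hN⟩ := (psiY a x).support.exists_nat_subset_range
    rw [Finsupp.sum_of_support_subset _ hN _ (by simp)] at h
    by_cases hm : m < N
    · exact DL_free N (fun m => phiL (psiY a x m)) (fun m => lamB_phiL _) h.symm m hm
    · have : m ∉ (psiY a x).support := fun h' => hm (Finset.mem_range.mp (hN h'))
      rw [Finsupp.notMem_support_iff.mp this, map_zero]

theorem phiL_injective : Function.Injective phiL := by
  rw [injective_iff_map_eq_zero]
  intro x hx
  ext w
  exact phiL_ker w x hx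

/-- the span of all `DL^m (phi x)` -/
noncomputable def MM : Submodule ℚ QB :=
  Submodule.span ℚ {y | ∃ (m : ℕ) (x : QY), y = (DL ^ m) (phiL x)}

theorem DL_MM (y : QB) (hy : y ∈ MM) : DL y ∈ MM := by
  have : MM ≤ MM.comap DL := by
    conv_lhs => rw [MM]
    rw [Submodule.span_le]
    rintro _ ⟨m, x, rfl⟩
    apply Submodule.subset_span
    exact ⟨m + 1, x, by rw [pow_succ', Module.End.mul_apply]⟩
  exact this hy

theorem cons_MM (a : ℕ) (y : QB) (hy : y ∈ MM) : consBL (a + 1) y ∈ LinearMap.range phiL := by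
  have : MM ≤ (LinearMap.range phiL).comap (consBL (a + 1)) := by
    rw [MM, Submodule.span_le]
    rintro _ ⟨m, x, rfl⟩
    exact ⟨consYL (a, m) x, phiL_cons _ _⟩
  exact this hy

theorem range_le_MM : LinearMap.range phiL ≤ MM := by
  rintro _ ⟨x, rfl⟩
  exact Submodule.subset_span ⟨0, x, by simp⟩

theorem zeros_cons_MM (n a : ℕ) : ∀ y ∈ MM, (consBL 0 ^ n) (consBL (a + 1) y) ∈ MM := by
  induction n with
  | zero => intro y hy; exact range_le_MM (cons_MM a y hy)
  | succ n ih =>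
    intro y hy
    have h1 := DL_zeros n (consBL (a + 1) y)
    rw [DL_cons, map_add, ← Module.End.mul_apply _ (consBL 0), ← pow_succ] at h1
    have hn : (n : ℚ) + 1 ≠ 0 := by positivity
    have h2 : (consBL 0 ^ (n + 1)) (consBL (a + 1) y) = ((n : ℚ) + 1)⁻¹ •
        (DL ((consBL 0 ^ n) (consBL (a + 1) y)) - (consBL 0 ^ n) (consBL (a + 1) (DL y))) := by
      rw [eq_inv_smul_iff₀ hn, h1]
      module
    rw [h2]
    exact MM.smul_mem _ (MM.sub_mem (DL_MM _ (ih y hy)) (ih _ (DL_MM y hy)))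

theorem zeros_nil_MM (n : ℕ) : (consBL 0 ^ n) (wB []) ∈ MM := by
  induction n with
  | zero => exact range_le_MM ⟨wY [], phiL_nil⟩
  | succ n ih =>
    have h0 : DL (wB []) = consBL 0 (wB []) := by rw [DL_wB, DW, consBL_wB]
    have h1 := DL_zeros n (wB [])
    rw [h0, ← Module.End.mul_apply _ (consBL 0), ← pow_succ] at h1
    have hn : (n : ℚ) + 1 ≠ 0 := by positivity
    have h2 : (consBL 0 ^ (n + 1)) (wB []) = ((n : ℚ) + 1)⁻¹ •
        (DL ((consBL 0 ^ n) (wB []))) := by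
      rw [eq_inv_smul_iff₀ hn, h1]
      module
    rw [h2]
    exact MM.smul_mem _ (DL_MM _ ih)

theorem zeros_word_MM (w : List ℕ) : ∀ n, (consBL 0 ^ n) (wB w) ∈ MM := by
  induction w with
  | nil => exact zeros_nil_MM
  | cons i w ih =>
    intro n
    rw [← consBL_wB]
    cases i with
    | zero => rw [← Module.End.mul_apply, ← pow_succ]; exact ih _
    | succ a => exact zeros_cons_MM n a _ (by simpa using ih 0)

theorem QB0_le_range : QB0 ≤ LinearMap.range phiL := by
  rw [QB0, Submodule.span_le]
  rintro _ ⟨w, hw, rfl⟩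
  rcases w with _ | ⟨i, w⟩
  · exact ⟨wY [], phiL_nil⟩
  · cases i with
    | zero => simp at hw
    | succ a =>
      rw [← consBL_wB]
      exact cons_MM a _ (by simpa using zeros_word_MM w 0)

/-- the span of the words of weight `W` -/
noncomputable def SW (W : ℕ) : Submodule ℚ QB :=
  Submodule.span ℚ {v | ∃ w : List ℕ, wtB w = W ∧ v = wB w}

/-- the span of the words of weight `W` not starting in `b₀` -/
noncomputable def SW0 (W : ℕ) : Submodule ℚ QB :=
  Submodule.span ℚ {v : QB | ∃ w : List ℕ, wtB w = W ∧ w.head? ≠ some 0 ∧ v = wB w}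

theorem SW0_le_SW (W : ℕ) : SW0 W ≤ SW W := by
  apply Submodule.span_mono
  rintro _ ⟨w, h1, _, h2⟩
  exact ⟨w, h1, h2⟩

theorem SW0_le_QB0 (W : ℕ) : SW0 W ≤ QB0 := by
  apply Submodule.span_mono
  rintro _ ⟨w, _, h1, h2⟩
  exact ⟨w, h1, h2⟩

theorem wtB_zero_cons (w : List ℕ) : wtB (0 :: w) = wtB w + 1 := by
  simp [wtB]; omega

theorem wtB_succ_cons (a : ℕ) (w : List ℕ) : wtB ((a + 1) :: w) = wtB w + (a + 1) := by
  simp [wtB]; omega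

theorem cons_SW0 (a W : ℕ) (y : QB) (hy : y ∈ SW W) : consBL (a + 1) y ∈ SW0 (W + (a + 1)) := by
  have : SW W ≤ (SW0 (W + (a + 1))).comap (consBL (a + 1)) := by
    rw [SW, Submodule.span_le]
    rintro _ ⟨w, rfl, rfl⟩
    apply Submodule.subset_span
    exact ⟨(a + 1) :: w, wtB_succ_cons a w, by simp, consBL_wB _ _⟩
  exact this hy

theorem cons_zero_SW (W : ℕ) (y : QB) (hy : y ∈ SW W) : consBL 0 y ∈ SW (W + 1) := by
  have : SW W ≤ (SW (W + 1)).comap (consBL 0) := by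
    conv_lhs => rw [SW]
    rw [Submodule.span_le]
    rintro _ ⟨w, rfl, rfl⟩
    apply Submodule.subset_span
    exact ⟨0 :: w, wtB_zero_cons w, consBL_wB _ _⟩
  exact this hy

theorem wB_SW (w : List ℕ) : wB w ∈ SW (wtB w) := Submodule.subset_span ⟨w, rfl, rfl⟩

theorem DL_wB_SW (w : List ℕ) : DL (wB w) ∈ SW (wtB w + 1) := by
  induction w with
  | nil => rw [DL_wB, DW, ← consBL_wB]; exact cons_zero_SW _ _ (wB_SW _)
  | cons i w ih =>
    rw [← consBL_wB, DL_cons]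
    apply Submodule.add_mem
    · rw [consBL_wB]; exact cons_zero_SW _ _ (wB_SW _)
    · cases i with
      | zero => rw [wtB_zero_cons]; exact cons_zero_SW _ _ ih
      | succ a =>
        rw [wtB_succ_cons, add_right_comm]
        exact SW0_le_SW _ (cons_SW0 a _ _ ih)

theorem DL_SW (W : ℕ) (y : QB) (hy : y ∈ SW W) : DL y ∈ SW (W + 1) := by
  have : SW W ≤ (SW (W + 1)).comap DL := by
    conv_lhs => rw [SW]
    rw [Submodule.span_le]
    rintro _ ⟨w, rfl, rfl⟩
    exact DL_wB_SW w
  exact this hy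

theorem DL_pow_SW (m W : ℕ) (y : QB) (hy : y ∈ SW W) : (DL ^ m) y ∈ SW (W + m) := by
  induction m with
  | zero => simpa using hy
  | succ m ih =>
    rw [pow_succ', Module.End.mul_apply]
    exact DL_SW _ _ ih

theorem phiW_SW0 (w : List (ℕ × ℕ)) : phiW w ∈ SW0 (wtY w) := by
  induction w with
  | nil =>
    rw [phiW_nil]
    exact Submodule.subset_span ⟨[], by simp [wtB, wtY], by simp, rfl⟩
  | cons y w ih =>
    rw [phiW_cons]
    have h := cons_SW0 y.1 _ _ (DL_pow_SW y.2 _ _ (SW0_le_SW _ ih))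
    have e : wtY (y :: w) = wtY w + y.2 + (y.1 + 1) := by
      simp [wtY]; omega
    rw [e]
    exact h

theorem range_le_QB0 : LinearMap.range phiL ≤ QB0 := by
  rintro _ ⟨x, rfl⟩
  rw [phiL, Finsupp.linearCombination_apply]
  exact Submodule.sum_mem _ fun w _ => QB0.smul_mem _ (SW0_le_QB0 _ (phiW_SW0 w))

/-- `φ_#` is a bijective algebra morphism
`(ℚ⟨Y^bi⟩, ∗) → (ℚ⟨B⟩⁰, ∗_b)` mapping weight-`W` elements to weight-`W` elements. -/
theorem phi_sharp_graded_algebra_isomorphism :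
    Function.Injective phi ∧
    Set.range phi = (QB0 : Set QB) ∧
    (∀ x y : QY, phi (stuf x y) = bsh (phi x) (phi y)) ∧
    phi (wY []) = wB [] ∧
    (∀ W : ℕ, ∀ x : QY,
      x ∈ Submodule.span ℚ {v : QY | ∃ w : List (ℕ × ℕ), wtY w = W ∧ v = wY w} →
      phi x ∈ Submodule.span ℚ
        {v : QB | ∃ w : List ℕ, wtB w = W ∧ w.head? ≠ some 0 ∧ v = wB w}) := by
  refine ⟨phiL_injective, ?_, ?_, phiL_nil, ?_⟩
  · have h : LinearMap.range phiL = QB0 := le_antisymm range_le_QB0 QB0_le_range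
    rw [← h]
    rfl
  · intro x y
    rw [stuf_eq, bsh_eq]
    exact phiL_stufL x y
  · intro W x hx
    have : Submodule.span ℚ {v : QY | ∃ w : List (ℕ × ℕ), wtY w = W ∧ v = wY w} ≤
        (SW0 W).comap phiL := by
      rw [Submodule.span_le]
      rintro _ ⟨w, rfl, rfl⟩
      change phiL (wY w) ∈ SW0 (wtY w)
      rw [phiL_wY]
      exact phiW_SW0 w
    exact this hx
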